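/- Let B be an associative unital ℂ-algebra, F a nonzero finite-dimensional complex vector space, A = B ⊗_ℂ End_ℂ(F), and e ∈ A an idempotent. Then every nonzero simple left eAe-module N is hit by a simple module under the translation functor: there exists a simple left B-module M together with an isomorphism of eAe-modules e·(M ⊗_ℂ F) ≅ N. -/

import Mathlib

section CornerSetup

variable {A : Type*} [Ring A]

/-- The corner ring `eAe = {x : A | e * x = x ∧ x * e = x}` attached to an idempotent `e`. -/
structure Corner (e : A) (he : e * e = e) where
  val : A
  eq_left : e * val = val
  eq_right : val * e = val

namespace Corner

variable {e : A} {he : e * e = e}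

theorem ext' {c d : Corner e he} (h : c.val = d.val) : c = d := by
  cases c; cases d; cases h; rfl

instance : Add (Corner e he) :=
  ⟨fun c d => ⟨c.val + d.val, by rw [mul_add, c.eq_left, d.eq_left],
    by rw [add_mul, c.eq_right, d.eq_right]⟩⟩

instance : Zero (Corner e he) := ⟨⟨0, mul_zero e, zero_mul e⟩⟩

instance : Neg (Corner e he) :=
  ⟨fun a => ⟨-a.val, by rw [mul_neg, a.eq_left], by rw [neg_mul, a.eq_right]⟩⟩

instance : Mul (Corner e he) :=
  ⟨fun a b => ⟨a.val * b.val, by rw [← mul_assoc, a.eq_left], by rw [mul_assoc, b.eq_right]⟩⟩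

instance : One (Corner e he) := ⟨⟨e, he, he⟩⟩

instance : Ring (Corner e he) where
  add := (· + ·)
  add_assoc a b c := ext' (add_assoc _ _ _)
  zero := 0
  zero_add a := ext' (zero_add _)
  add_zero a := ext' (add_zero _)
  add_comm a b := ext' (add_comm _ _)
  neg := Neg.neg
  nsmul := nsmulRec
  zsmul := zsmulRec
  neg_add_cancel a := ext' (neg_add_cancel _)
  mul := (· * ·)
  mul_assoc a b c := ext' (mul_assoc _ _ _)
  one := 1
  one_mul a := ext' a.eq_left
  mul_one a := ext' a.eq_right
  left_distrib a b c := ext' (mul_add _ _ _)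
  right_distrib a b c := ext' (add_mul _ _ _)
  zero_mul a := ext' (zero_mul _)
  mul_zero a := ext' (mul_zero _)

end Corner

end CornerSetup

open scoped TensorProduct

set_option maxSynthPendingDepth 2

/-- A left `B`-module `M` (with its underlying `ℂ`-vector space structure), packaged together
with the `B ⊗[ℂ] End_ℂ(F)`-module structure on `M ⊗[ℂ] F` determined by the formula
`(b ⊗ f) • (m ⊗ v) = (b • m) ⊗ f v`. -/
structure TModule (B : Type) [Ring B] [Algebra ℂ B]
    (F : Type) [AddCommGroup F] [Module ℂ F] where
  carrier : Type
  [acg : AddCommGroup carrier]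
  [modC : Module ℂ carrier]
  [modB : Module B carrier]
  [tower : IsScalarTower ℂ B carrier]
  [modA : Module (B ⊗[ℂ] Module.End ℂ F) (carrier ⊗[ℂ] F)]
  smul_def : ∀ (b : B) (f : Module.End ℂ F) (m : carrier) (v : F),
    (b ⊗ₜ[ℂ] f) • (m ⊗ₜ[ℂ] v) = (b • m) ⊗ₜ[ℂ] (f v)

attribute [instance] TModule.acg TModule.modC TModule.modB TModule.tower TModule.modA

section CornerSimple

variable {A N : Type*} [Ring A] {e : A} {he : e * e = e} [AddCommGroup N]
  [Module (Corner e he) N]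

/-- The compression `e * a * e` of `a`, as an element of the corner ring. -/
def Corner.compress (he : e * e = e) (a : A) : Corner e he where
  val := e * a * e
  eq_left := by simp only [← mul_assoc, he]
  eq_right := by simp only [mul_assoc, he]

theorem Corner.compress_add (a b : A) :
    Corner.compress he (a + b) = Corner.compress he a + Corner.compress he b :=
  Corner.ext' (show e * (a + b) * e = e * a * e + e * b * e by noncomm_ring)

theorem Corner.compress_zero : Corner.compress he 0 = 0 :=
  Corner.ext' (show e * 0 * e = 0 by simp)

theorem Corner.compress_mul_val (a : A) (c : Corner e he) :
    Corner.compress he (a * c.val) = Corner.compress he a * c :=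
  Corner.ext' (show e * (a * c.val) * e = e * a * e * c.val by
    simp only [mul_assoc, c.eq_left, c.eq_right])

/-- The largest left ideal of `A` whose compression to `eAe` annihilates `n`. -/
def cornerAnnihilator (e : A) (he : e * e = e) [Module (Corner e he) N] (n : N) :
    Submodule A A where
  carrier := {a | ∀ b : A, Corner.compress he (b * a) • n = 0}
  add_mem' {x y} hx hy b := by
    rw [mul_add, Corner.compress_add, add_smul, hx b, hy b, add_zero]
  zero_mem' b := by rw [mul_zero, Corner.compress_zero, zero_smul]
  smul_mem' c x hx b := by
    rw [smul_eq_mul, ← mul_assoc]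
    exact hx (b * c)

theorem mem_cornerAnnihilator {n : N} {a : A} :
    a ∈ cornerAnnihilator e he n ↔ ∀ b : A, Corner.compress he (b * a) • n = 0 :=
  Iff.rfl

theorem val_mem_cornerAnnihilator {n : N} {c : Corner e he} :
    c.val ∈ cornerAnnihilator e he n ↔ c • n = 0 := by
  simp only [mem_cornerAnnihilator, Corner.compress_mul_val, mul_smul]
  refine ⟨fun h => ?_, fun h b => by rw [h, smul_zero]⟩
  have h1 : Corner.compress he 1 = 1 := Corner.ext' (show e * 1 * e = e by rw [mul_one, he])
  simpa only [h1, one_smul] using h 1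

theorem mul_one_sub_mem_cornerAnnihilator (n : N) (a : A) :
    a - a * e ∈ cornerAnnihilator e he n := by
  intro b
  have : Corner.compress he (b * (a - a * e)) = 0 := Corner.ext' <| by
    change e * (b * (a - a * e)) * e = 0
    simp only [mul_sub, sub_mul, mul_assoc, he, sub_self]
  rw [this, zero_smul]

theorem isSimpleModule_quotient_cornerAnnihilator [IsSimpleModule (Corner e he) N] {n : N}
    (hn : n ≠ 0) : IsSimpleModule A (A ⧸ cornerAnnihilator e he n) := by
  rw [isSimpleModule_iff_isCoatom]
  refine ⟨fun h => hn ?_, fun J hJ => ?_⟩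
  · have : (1 : Corner e he).val ∈ cornerAnnihilator e he n := h ▸ Submodule.mem_top
    simpa only [val_mem_cornerAnnihilator, one_smul] using this
  · obtain ⟨a, haJ, ha⟩ := SetLike.exists_of_lt hJ
    simp only [mem_cornerAnnihilator, not_forall] at ha
    obtain ⟨b, hb⟩ := ha
    obtain ⟨c, hc⟩ := IsSimpleModule.toSpanSingleton_surjective (Corner e he) hb n
    rw [LinearMap.toSpanSingleton_apply, ← mul_smul] at hc
    have hx : (c * Corner.compress he (b * a)).val - c.val * b * a * e = 0 := by
      change c.val * (e * (b * a) * e) - _ = 0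
      simp only [← mul_assoc, c.eq_right, sub_self]
    have hmem : (1 : Corner e he).val - c.val * b * a * e ∈ cornerAnnihilator e he n := by
      rw [← sub_eq_zero.1 hx]
      have h0 : (1 - c * Corner.compress he (b * a)) • n = 0 := by
        rw [sub_smul, hc, one_smul, sub_self]
      rw [← val_mem_cornerAnnihilator (he := he), sub_eq_add_neg] at h0
      rw [sub_eq_add_neg]
      exact h0
    rw [Submodule.eq_top_iff']
    intro y
    have h1 := hJ.le hmem
    have h2 := hJ.le (mul_one_sub_mem_cornerAnnihilator (he := he) n (c.val * b * a))
    have h3 := hJ.le (mul_one_sub_mem_cornerAnnihilator (he := he) n 1)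
    have h4 : c.val * b * a ∈ J := J.smul_mem (c.val * b) haJ
    have h5 : (1 : A) ∈ J := by
      have := J.add_mem (J.sub_mem (J.add_mem h1 h3) h2) h4
      change e - _ + _ - _ + _ ∈ J at this
      convert this using 1
      noncomm_ring
    simpa using J.smul_mem y h5

/-- A simple `eAe`-module is of the form `e • V` for a simple `A`-module `V`. -/
theorem exists_corner_equivariant_embedding [IsSimpleModule (Corner e he) N] {n : N}
    (hn : n ≠ 0) :
    ∃ θ : N → A ⧸ cornerAnnihilator e he n, Function.Injective θ ∧
      (∀ n₁ n₂ : N, θ (n₁ + n₂) = θ n₁ + θ n₂) ∧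
      (∀ (c : Corner e he) (n : N), θ (c • n) = c.val • θ n) ∧
      Set.range θ = {x | ∃ y, x = e • y} := by
  choose s hs using IsSimpleModule.toSpanSingleton_surjective (Corner e he) hn
  simp only [LinearMap.toSpanSingleton_apply] at hs
  have key (c d : Corner e he) : (Submodule.Quotient.mk c.val : A ⧸ cornerAnnihilator e he n) =
      Submodule.Quotient.mk d.val ↔ c • n = d • n := by
    rw [Submodule.Quotient.eq, ← sub_eq_zero (a := c • n), ← sub_smul,
      ← val_mem_cornerAnnihilator (he := he), sub_eq_add_neg c d, sub_eq_add_neg c.val]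
    rfl
  refine ⟨fun m => Submodule.Quotient.mk (s m).val, fun m m' h => ?_, fun m m' => ?_,
    fun c m => ?_, Set.ext fun x => ⟨?_, ?_⟩⟩
  · rw [← hs m, ← hs m', (key _ _).1 h]
  · exact (key _ (s m + s m')).2 (by rw [add_smul, hs, hs, hs])
  · exact (key _ (c * s m)).2 (by rw [mul_smul, hs, hs])
  · rintro ⟨m, rfl⟩
    refine ⟨Submodule.Quotient.mk (s m).val, ?_⟩
    rw [← Submodule.Quotient.mk_smul, smul_eq_mul, (s m).eq_left]
  · rintro ⟨y, rfl⟩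
    obtain ⟨a, rfl⟩ := Submodule.Quotient.mk_surjective _ y
    refine ⟨Corner.compress he a • n, ((key _ (Corner.compress he a)).2 (hs _)).trans ?_⟩
    rw [← Submodule.Quotient.mk_smul, eq_comm, Submodule.Quotient.eq]
    exact mul_one_sub_mem_cornerAnnihilator n (e * a)

end CornerSimple

section Untensor

variable {B F V : Type} [Ring B] [Algebra ℂ B] [AddCommGroup F] [Module ℂ F]

theorem smulRight_mul_smulRight (φ ψ : Module.Dual ℂ F) (u v : F) :
    (φ.smulRight u * ψ.smulRight v : Module.End ℂ F) = φ v • ψ.smulRight u := by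
  ext x
  simp [smul_smul, mul_comm]

theorem one_tmul_smul_one_tmul_smul [AddCommGroup V]
    [Module (B ⊗[ℂ] Module.End ℂ F) V] (f g : Module.End ℂ F) (w : V) :
    ((1 : B) ⊗ₜ[ℂ] f) • ((1 : B) ⊗ₜ[ℂ] g) • w = ((1 : B) ⊗ₜ[ℂ] (f * g)) • w := by
  rw [← mul_smul, Algebra.TensorProduct.tmul_mul_tmul, one_mul]

section

variable [AddCommGroup V] [Module B V] [Module (B ⊗[ℂ] Module.End ℂ F) V]
  [IsScalarTower B (B ⊗[ℂ] Module.End ℂ F) V]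

theorem tmul_smul_eq_smul (b : B) (f : Module.End ℂ F) (w : V) :
    (b ⊗ₜ[ℂ] f) • w = b • ((1 : B) ⊗ₜ[ℂ] f) • w := by
  rw [← smul_assoc, TensorProduct.smul_tmul', smul_eq_mul, mul_one]

theorem one_tmul_smul_smul (b : B) (f : Module.End ℂ F) (w : V) :
    ((1 : B) ⊗ₜ[ℂ] f) • b • w = b • ((1 : B) ⊗ₜ[ℂ] f) • w := by
  have h : b • w = (b ⊗ₜ[ℂ] (1 : Module.End ℂ F)) • w := by
    rw [tmul_smul_eq_smul, ← Algebra.TensorProduct.one_def, one_smul]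
  rw [h, ← mul_smul, Algebra.TensorProduct.tmul_mul_tmul, one_mul, mul_one, tmul_smul_eq_smul]

variable (B V) in
/-- The `B`-submodule of vectors fixed by `1 ⊗ p`. -/
def fixedSubmodule (p : Module.End ℂ F) : Submodule B V where
  carrier := {w | ((1 : B) ⊗ₜ[ℂ] p) • w = w}
  add_mem' {x y} hx hy := by
    rw [Set.mem_ofPred_eq] at *
    rw [smul_add, hx, hy]
  zero_mem' := smul_zero _
  smul_mem' b w hw := by
    rw [Set.mem_ofPred_eq] at *
    rw [one_tmul_smul_smul, hw]

theorem mem_fixedSubmodule {p : Module.End ℂ F} {w : V} :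
    w ∈ fixedSubmodule B V p ↔ ((1 : B) ⊗ₜ[ℂ] p) • w = w :=
  Iff.rfl

theorem isSimpleModule_fixedSubmodule [IsSimpleModule (B ⊗[ℂ] Module.End ℂ F) V]
    {φ : Module.Dual ℂ F} {v : F} (h : fixedSubmodule B V (φ.smulRight v) ≠ ⊥) :
    IsSimpleModule B (fixedSubmodule B V (φ.smulRight v)) := by
  rw [isSimpleModule_iff_toSpanSingleton_surjective]
  refine ⟨Submodule.nontrivial_iff_ne_bot.2 h, fun m hm m' => ?_⟩
  obtain ⟨a, ha⟩ := IsSimpleModule.toSpanSingleton_surjective (B ⊗[ℂ] Module.End ℂ F)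
    (m := (m : V)) (by simpa using hm) m'
  rw [LinearMap.toSpanSingleton_apply] at ha
  have key (a : B ⊗[ℂ] Module.End ℂ F) : ∃ b : B,
      ((1 : B) ⊗ₜ[ℂ] φ.smulRight v) • a • (m : V) = b • (m : V) := by
    induction a with
    | zero =>
      refine ⟨0, ?_⟩
      rw [zero_smul B]
      exact (congrArg _ (zero_smul (B ⊗[ℂ] Module.End ℂ F) (m : V))).trans (smul_zero _)
    | add x y hx hy =>
      obtain ⟨b, hb⟩ := hx
      obtain ⟨c, hc⟩ := hy
      exact ⟨b + c, by rw [add_smul, smul_add, hb, hc, add_smul]⟩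
    | tmul b f =>
      refine ⟨φ (f v) • b, ?_⟩
      conv_lhs => rw [← mem_fixedSubmodule.1 m.2]
      rw [← mul_smul, ← mul_smul, Algebra.TensorProduct.tmul_mul_tmul,
        Algebra.TensorProduct.tmul_mul_tmul, one_mul, mul_one]
      have : (φ.smulRight v * f * φ.smulRight v : Module.End ℂ F) =
          φ (f v) • φ.smulRight v := by
        ext x
        simp [smul_smul, mul_comm]
      rw [this, ← TensorProduct.smul_tmul, tmul_smul_eq_smul, mem_fixedSubmodule.1 m.2]
  obtain ⟨b, hb⟩ := key a
  refine ⟨b, Subtype.ext ?_⟩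
  rw [ha, mem_fixedSubmodule.1 m'.2] at hb
  exact hb.symm

end

variable [AddCommGroup V] [Module ℂ V] [Module B V] [IsScalarTower ℂ B V]
  [Module (B ⊗[ℂ] Module.End ℂ F) V] [IsScalarTower B (B ⊗[ℂ] Module.End ℂ F) V]

theorem one_tmul_smul_smul_complex (c : ℂ) (f : Module.End ℂ F) (w : V) :
    ((1 : B) ⊗ₜ[ℂ] (c • f)) • w = c • ((1 : B) ⊗ₜ[ℂ] f) • w := by
  rw [← TensorProduct.smul_tmul, tmul_smul_eq_smul, smul_assoc, one_smul]

theorem one_tmul_smul_complex_smul (c : ℂ) (f : Module.End ℂ F) (w : V) :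
    ((1 : B) ⊗ₜ[ℂ] f) • c • w = c • ((1 : B) ⊗ₜ[ℂ] f) • w := by
  rw [← one_smul B w, ← smul_assoc c (1 : B) w, one_tmul_smul_smul, smul_assoc, one_smul, one_smul]

/-- The map `m ⊗ v ↦ (1 ⊗ φ(·) v) • m`. -/
noncomputable def untensor (φ : Module.Dual ℂ F) (M : Submodule B V) : M ⊗[ℂ] F →ₗ[ℂ] V :=
  TensorProduct.lift <| LinearMap.mk₂ ℂ
    (fun m v => ((1 : B) ⊗ₜ[ℂ] (φ.smulRight v : Module.End ℂ F)) • (m : V))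
    (fun m m' v => by rw [Submodule.coe_add, smul_add])
    (fun c m v => by rw [Submodule.coe_smul_of_tower, one_tmul_smul_complex_smul])
    (fun m v v' => by
      rw [← add_smul, ← TensorProduct.tmul_add]
      congr 2
      ext x
      simp)
    (fun c m v => by
      rw [← one_tmul_smul_smul_complex]
      congr 2
      ext x
      simp [smul_comm c])

theorem untensor_tmul (φ : Module.Dual ℂ F) (M : Submodule B V) (m : M) (v : F) :
    untensor φ M (m ⊗ₜ v) = ((1 : B) ⊗ₜ[ℂ] (φ.smulRight v : Module.End ℂ F)) • (m : V) :=
  rfl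

/-- For `φ v₀ = 1`, the action of `1 ⊗ ψ(·) v₀`, whose values are fixed by `1 ⊗ φ(·) v₀`. -/
noncomputable def coordFixed {φ : Module.Dual ℂ F} {v₀ : F} (h : φ v₀ = 1)
    (ψ : Module.Dual ℂ F) : V →ₗ[ℂ] fixedSubmodule B V (φ.smulRight v₀) where
  toFun w := ⟨((1 : B) ⊗ₜ[ℂ] (ψ.smulRight v₀ : Module.End ℂ F)) • w, by
    rw [mem_fixedSubmodule, one_tmul_smul_one_tmul_smul, smulRight_mul_smulRight, h, one_smul]⟩
  map_add' w w' := Subtype.ext (smul_add _ w w')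
  map_smul' c w := Subtype.ext (one_tmul_smul_complex_smul c _ w)

/-- If `φ v₀ = 1`, then `V` is the tensor product with `F` of the vectors fixed by the rank one
projection `φ(·) v₀`. -/
noncomputable def untensorEquiv [FiniteDimensional ℂ F] {φ : Module.Dual ℂ F} {v₀ : F}
    (h : φ v₀ = 1) : fixedSubmodule B V (φ.smulRight v₀) ⊗[ℂ] F ≃ₗ[ℂ] V :=
  LinearEquiv.ofLinearMap (untensor φ _)
    (∑ i, (TensorProduct.mk ℂ _ F).flip (Module.finBasis ℂ F i) ∘ₗ
      coordFixed h ((Module.finBasis ℂ F).coord i))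
    (by
      ext w
      have hsum : ∑ i, (((Module.finBasis ℂ F).coord i).smulRight (Module.finBasis ℂ F i) :
          Module.End ℂ F) = 1 := by
        ext x
        simp
      simp only [LinearMap.comp_apply, LinearMap.sum_apply, map_sum, LinearMap.flip_apply,
        TensorProduct.mk_apply, untensor_tmul, coordFixed, LinearMap.coe_mk, AddHom.coe_mk,
        one_tmul_smul_one_tmul_smul, smulRight_mul_smulRight, h, one_smul, LinearMap.id_apply]
      rw [← Finset.sum_smul, ← TensorProduct.tmul_sum, hsum, ← Algebra.TensorProduct.one_def,
        one_smul])
    (by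
      ext m v
      have hcoord (ψ : Module.Dual ℂ F) : coordFixed h ψ
          (((1 : B) ⊗ₜ[ℂ] (φ.smulRight v : Module.End ℂ F)) • (m : V)) = ψ v • m := by
        refine Subtype.ext ?_
        change ((1 : B) ⊗ₜ[ℂ] (ψ.smulRight v₀ : Module.End ℂ F)) • _ = _
        rw [one_tmul_smul_one_tmul_smul, smulRight_mul_smulRight, one_tmul_smul_smul_complex,
          mem_fixedSubmodule.1 m.2, Submodule.coe_smul_of_tower]
      simp only [TensorProduct.AlgebraTensorModule.curry_apply, TensorProduct.curry_apply,
        LinearMap.restrictScalars_self, LinearMap.comp_apply, LinearMap.sum_apply,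
        untensor_tmul, hcoord, LinearMap.flip_apply, TensorProduct.mk_apply,
        LinearMap.id_apply, TensorProduct.smul_tmul, ← TensorProduct.tmul_sum,
        Module.Basis.coord_apply, Module.Basis.sum_repr])

theorem untensorEquiv_tmul [FiniteDimensional ℂ F] {φ : Module.Dual ℂ F} {v₀ : F}
    (h : φ v₀ = 1) (m : fixedSubmodule B V (φ.smulRight v₀)) (v : F) :
    untensorEquiv h (m ⊗ₜ v) =
      ((1 : B) ⊗ₜ[ℂ] (φ.smulRight v : Module.End ℂ F)) • (m : V) :=
  rfl

/-- The `TModule` of vectors fixed by the rank one projection `φ(·) v₀`, where `φ v₀ = 1`. -/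
noncomputable def fixedTModule [FiniteDimensional ℂ F] {φ : Module.Dual ℂ F} {v₀ : F}
    (V : Type) [AddCommGroup V] [Module ℂ V] [Module B V] [IsScalarTower ℂ B V]
    [Module (B ⊗[ℂ] Module.End ℂ F) V] [IsScalarTower B (B ⊗[ℂ] Module.End ℂ F) V]
    (h : φ v₀ = 1) : TModule B F :=
  letI : Module (B ⊗[ℂ] Module.End ℂ F) (fixedSubmodule B V (φ.smulRight v₀) ⊗[ℂ] F) :=
    (untensorEquiv h).toAddEquiv.module (B ⊗[ℂ] Module.End ℂ F)
  { carrier := fixedSubmodule B V (φ.smulRight v₀)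
    smul_def b f m v := by
      apply (untensorEquiv h).injective
      change untensorEquiv h ((untensorEquiv h).symm ((b ⊗ₜ f) • untensorEquiv h (m ⊗ₜ v))) = _
      rw [LinearEquiv.apply_symm_apply, untensorEquiv_tmul, untensorEquiv_tmul,
        Submodule.coe_smul, one_tmul_smul_smul, tmul_smul_eq_smul, one_tmul_smul_one_tmul_smul]
      congr 3
      ext x
      simp }

/-- Every simple `B ⊗ End F`-module is of the form `M ⊗ F` for a simple `B`-module `M`. -/
theorem exists_tensor_equiv_of_isSimpleModule [Nontrivial F] [FiniteDimensional ℂ F]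
    [IsSimpleModule (B ⊗[ℂ] Module.End ℂ F) V] :
    ∃ M : TModule B F, IsSimpleModule B M.carrier ∧
      Nonempty (M.carrier ⊗[ℂ] F ≃ₗ[B ⊗[ℂ] Module.End ℂ F] V) := by
  obtain ⟨v₀, hv₀⟩ := exists_ne (0 : F)
  obtain ⟨φ, hφ⟩ := Module.Projective.exists_dual_eq_one ℂ hv₀
  refine ⟨fixedTModule V hφ, isSimpleModule_fixedSubmodule fun hbot => ?_,
    ⟨{ (untensorEquiv hφ).toAddEquiv with
      map_smul' := fun a x => (untensorEquiv hφ).apply_symm_apply _ }⟩⟩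
  have := IsSimpleModule.nontrivial (B ⊗[ℂ] Module.End ℂ F) V
  have : Subsingleton (fixedSubmodule B V (φ.smulRight v₀)) :=
    (Submodule.subsingleton_iff_eq_bot).2 hbot
  exact not_subsingleton V (untensorEquiv (B := B) (V := V) hφ).symm.toEquiv.subsingleton

end Untensor

/-- **Simple `eAe`-modules are translates of simple `B`-modules.** Let `B` be a unital
`ℂ`-algebra, `F` a nonzero finite-dimensional complex vector space, `A = B ⊗[ℂ] End_ℂ(F)`,
and `e ∈ A` an idempotent.  Every (nonzero) simple left `eAe`-module `N` is hit by a simple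
module under the translation functor: there is a simple left `B`-module `M` and an
isomorphism of `eAe`-modules `e • (M ⊗[ℂ] F) ≅ N`. -/
theorem simple_corner_module_is_translate (B : Type) [Ring B] [Algebra ℂ B]
    (F : Type) [AddCommGroup F] [Module ℂ F] [Nontrivial F] [FiniteDimensional ℂ F]
    (e : B ⊗[ℂ] Module.End ℂ F) (he : e * e = e)
    (N : Type) [AddCommGroup N] [Module (Corner e he) N] [IsSimpleModule (Corner e he) N] :
    ∃ M : TModule B F, IsSimpleModule B M.carrier ∧
      -- an isomorphism of `eAe`-modules `N ≅ e • (M.carrier ⊗[ℂ] F)`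
      ∃ θ : N → M.carrier ⊗[ℂ] F,
        Function.Injective θ ∧
        (∀ n₁ n₂ : N, θ (n₁ + n₂) = θ n₁ + θ n₂) ∧
        (∀ (c : Corner e he) (n : N), θ (c • n) = c.val • θ n) ∧
        Set.range θ = {x : M.carrier ⊗[ℂ] F | ∃ y : M.carrier ⊗[ℂ] F, x = e • y} := by
  have := IsSimpleModule.nontrivial (Corner e he) N
  obtain ⟨n, hn⟩ := exists_ne (0 : N)
  have := isSimpleModule_quotient_cornerAnnihilator (he := he) hn
  obtain ⟨θ, hinj, hadd, hsmul, hrange⟩ := exists_corner_equivariant_embedding (he := he) hn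
  obtain ⟨M, hM, ⟨g⟩⟩ := exists_tensor_equiv_of_isSimpleModule (B := B) (F := F)
    (V := (B ⊗[ℂ] Module.End ℂ F) ⧸ cornerAnnihilator e he n)
  refine ⟨M, hM, g.symm ∘ θ, g.symm.injective.comp hinj, fun n₁ n₂ => ?_, fun c m => ?_, ?_⟩
  · simp only [Function.comp_apply, hadd, map_add]
  · simp only [Function.comp_apply, hsmul, map_smul]
  · rw [Set.range_comp, hrange]
    ext x
    constructor
    · rintro ⟨_, ⟨y, rfl⟩, rfl⟩
      exact ⟨g.symm y, map_smul g.symm e y⟩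
    · rintro ⟨y, rfl⟩
      exact ⟨e • g y, ⟨g y, rfl⟩, by rw [map_smul, g.symm_apply_apply]⟩
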